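/- arXiv:2303.01704 — 2 statements merged into one kernel-verified Lean document; each statement's English description precedes it below -/
import Mathlib

section
/- Let G be a finite set, let Λ ⊆ ℝᵏ be a nonempty convex compact set, and let L : Δ(G) × Λ → ℝ be affine in each argument separately (biaffine), where Δ(G) is the simplex of probability distributions on G. Let p₁, …, p_T ∈ Δ(G) and λ₁, …, λ_T ∈ Λ be sequences such that the maximizing player has cumulative regret at most R_p, i.e., max_{p∈Δ(G)} Σ_{t=1}^T L(p, λ_t) − Σ_{t=1}^T L(p_t, λ_t) ≤ R_p, and the minimizing player has cumulative regret at most R_λ, i.e., Σ_{t=1}^T L(p_t, λ_t) − min_{λ∈Λ} Σ_{t=1}^T L(p_t, λ) ≤ R_λ. Then the averaged plays p̄ = (1/T)Σ_t p_t and λ̄ = (1/T)Σ_t λ_t satisfy max_{p∈Δ(G)} L(p, λ̄) − min_{λ∈Λ} L(p̄, λ) ≤ (R_p + R_λ)/T; in particular (p̄, λ̄) is a ((R_p + R_λ)/T)-approximate saddle point of L. -/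
theorem avg_aux {E : Type*} [AddCommGroup E] [Module ℝ E] (S : Set E) (hS : Convex ℝ S)
    (f : E → ℝ) (hf : ∀ p ∈ S, ∀ q ∈ S, ∀ a b : ℝ, 0 ≤ a → 0 ≤ b → a + b = 1 →
      f (a • p + b • q) = a * f p + b * f q) (x : ℕ → E) (hx : ∀ t, x t ∈ S) (n : ℕ) :
    (((n + 1 : ℕ) : ℝ)⁻¹ • ∑ t ∈ Finset.range (n + 1), x t) ∈ S ∧
    f (((n + 1 : ℕ) : ℝ)⁻¹ • ∑ t ∈ Finset.range (n + 1), x t) =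
      ((n + 1 : ℕ) : ℝ)⁻¹ * ∑ t ∈ Finset.range (n + 1), f (x t) := by
  induction n with
  | zero => simp [hx]
  | succ n ih =>
    obtain ⟨h1, h2⟩ := ih
    have e : (((n + 1 + 1 : ℕ) : ℝ)⁻¹ • ∑ t ∈ Finset.range (n + 1 + 1), x t) =
        (((n + 1 : ℕ) : ℝ) / ((n + 1 + 1 : ℕ) : ℝ)) •
          (((n + 1 : ℕ) : ℝ)⁻¹ • ∑ t ∈ Finset.range (n + 1), x t) +
        (((n + 1 + 1 : ℕ) : ℝ)⁻¹) • x (n + 1) := by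
      rw [Finset.sum_range_succ _ (n + 1), smul_add, smul_smul]
      congr 2
      field_simp
    have hab : (((n + 1 : ℕ) : ℝ) / ((n + 1 + 1 : ℕ) : ℝ)) + ((n + 1 + 1 : ℕ) : ℝ)⁻¹ = 1 := by
      field_simp
      push_cast
      ring
    have ha : 0 ≤ (((n + 1 : ℕ) : ℝ) / ((n + 1 + 1 : ℕ) : ℝ)) := by positivity
    have hb : 0 ≤ ((n + 1 + 1 : ℕ) : ℝ)⁻¹ := by positivity
    rw [e]
    refine ⟨hS h1 (hx _) ha hb hab, ?_⟩
    rw [hf _ h1 _ (hx _) _ _ ha hb hab, h2, Finset.sum_range_succ _ (n + 1)]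
    field_simp

/-!
No-regret dynamics converge to an approximate saddle point (Freund–Schapire):
if both players of a zero-sum game with biaffine payoff `L` on
`Δ(G) × Λ` (with `G` finite, `Λ ⊆ ℝᵏ` nonempty convex compact) have cumulative
regret at most `R_p` and `R_λ` respectively, then the averaged plays
`(p̄, λ̄)` form a `((R_p + R_λ)/T)`-approximate saddle point of `L`.
-/
theorem no_regret_dynamics_approx_saddle
    (ι : Type) [Fintype ι] [Nonempty ι] (k : ℕ)
    -- the simplex of probability distributions on the finite set `G`
    (Δ : Set (ι → ℝ))
    (hΔ : Δ = {p : ι → ℝ | (∀ a, 0 ≤ p a) ∧ (∑ a, p a) = 1})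
    -- the nonempty convex compact dual domain `Λ ⊆ ℝᵏ`
    (Λ : Set (Fin k → ℝ)) (hΛne : Λ.Nonempty) (hΛconv : Convex ℝ Λ)
    (hΛcomp : IsCompact Λ)
    -- the payoff, affine in each argument separately
    (L : (ι → ℝ) → (Fin k → ℝ) → ℝ)
    (hLaffp : ∀ l ∈ Λ, ∀ p ∈ Δ, ∀ q ∈ Δ, ∀ a b : ℝ, 0 ≤ a → 0 ≤ b → a + b = 1 →
      L (a • p + b • q) l = a * L p l + b * L q l)
    (hLaffl : ∀ p ∈ Δ, ∀ l ∈ Λ, ∀ m ∈ Λ, ∀ a b : ℝ, 0 ≤ a → 0 ≤ b → a + b = 1 →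
      L p (a • l + b • m) = a * L p l + b * L p m)
    -- the plays of the two players
    (T : ℕ) (hT : 0 < T)
    (ps : ℕ → ι → ℝ) (ls : ℕ → Fin k → ℝ)
    (hps : ∀ t, ps t ∈ Δ) (hls : ∀ t, ls t ∈ Λ)
    -- regret bounds for the maximizing (`p`) and minimizing (`λ`) players
    (Rp Rl : ℝ)
    (hRp : ∀ p ∈ Δ, (∑ t ∈ Finset.range T, L p (ls t)) -
      (∑ t ∈ Finset.range T, L (ps t) (ls t)) ≤ Rp)
    (hRl : ∀ l ∈ Λ, (∑ t ∈ Finset.range T, L (ps t) (ls t)) -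
      (∑ t ∈ Finset.range T, L (ps t) l) ≤ Rl)
    -- the averaged plays
    (pbar : ι → ℝ) (lbar : Fin k → ℝ)
    (hpbar : pbar = ((T : ℝ))⁻¹ • ∑ t ∈ Finset.range T, ps t)
    (hlbar : lbar = ((T : ℝ))⁻¹ • ∑ t ∈ Finset.range T, ls t) :
    -- duality gap bound: `max_p L(p, λ̄) - min_λ L(p̄, λ) ≤ (R_p + R_λ)/T`
    (∀ p ∈ Δ, ∀ l ∈ Λ, L p lbar - L pbar l ≤ (Rp + Rl) / T) ∧
    -- in particular `(p̄, λ̄)` is a `((R_p + R_λ)/T)`-approximate saddle point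
    (∀ p ∈ Δ, L p lbar - (Rp + Rl) / T ≤ L pbar lbar) ∧
    (∀ l ∈ Λ, L pbar lbar ≤ L pbar l + (Rp + Rl) / T) := by
  have hΔconv : Convex ℝ Δ := by
    have : Δ = stdSimplex ℝ ι := by rw [hΔ]; rfl
    rw [this]; exact convex_stdSimplex ℝ ι
  obtain ⟨n, rfl⟩ : ∃ n, T = n + 1 := ⟨T - 1, by omega⟩
  have hl : lbar ∈ Λ ∧ ∀ p ∈ Δ, L p lbar =
      ((n + 1 : ℕ) : ℝ)⁻¹ * ∑ t ∈ Finset.range (n + 1), L p (ls t) := by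
    have h := fun p hp => avg_aux Λ hΛconv (L p) (hLaffl p hp) ls hls n
    rw [hlbar]
    exact ⟨(h _ (hps 0)).1, fun p hp => (h p hp).2⟩
  have hp : pbar ∈ Δ ∧ ∀ l ∈ Λ, L pbar l =
      ((n + 1 : ℕ) : ℝ)⁻¹ * ∑ t ∈ Finset.range (n + 1), L (ps t) l := by
    have h := fun l hl => avg_aux Δ hΔconv (fun p => L p l) (hLaffp l hl) ps hps n
    rw [hpbar]
    exact ⟨(h _ (hls 0)).1, fun l hl => (h l hl).2⟩
  have key : ∀ p ∈ Δ, ∀ l ∈ Λ, L p lbar - L pbar l ≤ (Rp + Rl) / ((n + 1 : ℕ) : ℝ) := by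
    intro p hpm l hlm
    rw [hl.2 p hpm, hp.2 l hlm, ← mul_sub, div_eq_inv_mul]
    apply mul_le_mul_of_nonneg_left _ (by positivity)
    linarith [hRp p hpm, hRl l hlm]
  refine ⟨key, fun p hpm => ?_, fun l hlm => ?_⟩
  · linarith [key p hpm lbar hl.1]
  · linarith [key pbar hp.1 l hlm]
end

section
/- Let n ≥ 1, let v ∈ ℝⁿ be a vector of (centered) per-point importance values, and for a group-membership function g : Fin n → [0,1] write |g| = Σᵢ g(i), S(g) = Σᵢ g(i)·vᵢ, and, when |g| > 0, AVG(g) = |S(g)| / |g|. For each integer k with 1 ≤ k ≤ n let G_k = { g : Fin n → [0,1] : k − 1 < |g| ≤ k }, and suppose that for each nonempty G_k a maximizer g_k of |S(g)| over G_k is given. Let k̂ be a maximizer over such k of |S(g_k)|/k and set ĝ = g_{k̂}. Then for every g* with |g*| > 0, writing k* = ⌈|g*|⌉, one has AVG(ĝ) ≥ ((k* − 1)/k*) · AVG(g*). In particular, the two-step procedure of solving the size-constrained disparity problem on each size bucket and selecting the bucket with the largest normalized disparity maximizes the average feature importance disparity up to a multiplicative factor 1 − 1/⌈|g*|⌉,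 where g* is the true maximizer. -/
/-!
Reduction of AVG-FID maximization to size-constrained FID maximization: if for
each size bucket `G_k = {g : Fin n → [0,1] | k-1 < |g| ≤ k}` a maximizer `g_k`
of `|S(g)| = |Σᵢ g(i) vᵢ|` is given, and `k̂` maximizes the normalized value
`|S(g_k)|/k`, then `ĝ = g_k̂` approximately maximizes the average disparity
`AVG(g) = |S(g)|/|g|`: for every `g*` with `|g*| > 0` and `k* = ⌈|g*|⌉`,
`AVG(ĝ) ≥ ((k*-1)/k*) · AVG(g*)`.
-/
theorem bucket_selection_approximates_avg_fid
    (n : ℕ) (hn : 1 ≤ n) (v : Fin n → ℝ)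
    -- group size and (centered) subgroup importance
    (size S : (Fin n → ℝ) → ℝ)
    (hsize : ∀ g : Fin n → ℝ, size g = ∑ i, g i)
    (hS : ∀ g : Fin n → ℝ, S g = ∑ i, g i * v i)
    -- the size buckets `G_k`
    (Gk : ℕ → Set (Fin n → ℝ))
    (hGk : ∀ k, Gk k = {g : Fin n → ℝ |
      (∀ i, g i ∈ Set.Icc (0 : ℝ) 1) ∧ (k : ℝ) - 1 < size g ∧ size g ≤ (k : ℝ)})
    -- for each nonempty bucket, a maximizer of `|S(·)|` over the bucket
    (gk : ℕ → Fin n → ℝ)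
    (hgk : ∀ k, 1 ≤ k → k ≤ n → (Gk k).Nonempty →
      gk k ∈ Gk k ∧ ∀ g ∈ Gk k, |S g| ≤ |S (gk k)|)
    -- `k̂` maximizes the normalized value `|S(g_k)|/k` over such buckets
    (khat : ℕ) (hkhat1 : 1 ≤ khat) (hkhatn : khat ≤ n)
    (hkhatne : (Gk khat).Nonempty)
    (hkhatmax : ∀ k, 1 ≤ k → k ≤ n → (Gk k).Nonempty →
      |S (gk k)| / (k : ℝ) ≤ |S (gk khat)| / (khat : ℝ)) :
    -- conclusion: `ĝ = g_k̂` satisfies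
    -- `AVG(ĝ) ≥ ((k*-1)/k*) · AVG(g*)` for every valid `g*`, `k* = ⌈|g*|⌉`
    ∀ gstar : Fin n → ℝ, (∀ i, gstar i ∈ Set.Icc (0 : ℝ) 1) → 0 < size gstar →
      ((⌈size gstar⌉₊ : ℝ) - 1) / (⌈size gstar⌉₊ : ℝ) *
          (|S gstar| / size gstar) ≤
        |S (gk khat)| / size (gk khat) := by
  intro g hg hpos
  have hle : size g ≤ (⌈size g⌉₊ : ℝ) := Nat.le_ceil _
  have hlt : (⌈size g⌉₊ : ℝ) < size g + 1 := Nat.ceil_lt_add_one hpos.le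
  have hk1 : 1 ≤ ⌈size g⌉₊ := Nat.ceil_pos.mpr hpos
  have hkn : ⌈size g⌉₊ ≤ n := by
    apply Nat.ceil_le.mpr
    rw [hsize]
    calc ∑ i, g i ≤ ∑ _i : Fin n, (1 : ℝ) := Finset.sum_le_sum fun i _ => (hg i).2
      _ = n := by simp
  generalize ⌈size g⌉₊ = k at *
  have hmem : g ∈ Gk k := by
    rw [hGk]
    exact ⟨hg, by linarith, hle⟩
  have h1 := (hgk k hk1 hkn ⟨g, hmem⟩).2 g hmem
  have h2 := hkhatmax k hk1 hkn ⟨g, hmem⟩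
  have h3 := (hgk khat hkhat1 hkhatn hkhatne).1
  rw [hGk] at h3
  obtain ⟨_, h4, h5⟩ := h3
  have hc : (1 : ℝ) ≤ khat := by exact_mod_cast hkhat1
  have hk0 : (0 : ℝ) < k := by exact_mod_cast hk1
  have hs : 0 < size (gk khat) := by linarith
  calc ((k : ℝ) - 1) / k * (|S g| / size g)
      = (((k : ℝ) - 1) / size g) * (|S g| / k) := by ring
    _ ≤ 1 * (|S g| / k) := by
        apply mul_le_mul_of_nonneg_right _ (by positivity)
        rw [div_le_one hpos]
        linarith
    _ = |S g| / k := one_mul _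
    _ ≤ |S (gk k)| / k := by gcongr
    _ ≤ |S (gk khat)| / khat := h2
    _ ≤ |S (gk khat)| / size (gk khat) := by gcongr
end
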